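/- The excess of a weighted hypermobile equals minus the sum of the charges of its vertices, i.e. excess = −Σ_v σ(v) where σ(v) denotes the charge of the vertex v. -/

import Mathlib

open Finset

/-- The three types of vertices of a hypermobile: round, dark square, light square. -/
inductive HColor
  | round
  | dark
  | light
deriving DecidableEq

/-- The weight of a vertex: the sum of the weights of the incident edges. -/
noncomputable def vertexWeight {V : Type*} [Fintype V] [DecidableEq V]
    (G : SimpleGraph V) [DecidableRel G.Adj] (w : Sym2 V → ℝ) (v : V) : ℝ :=
  ∑ u ∈ G.neighborFinset v, w s(v, u)

/-- The degree of a vertex of a hypermobile: its degree in the tree plus its bud count. -/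
def vertexDegree {V : Type*} [Fintype V] [DecidableEq V]
    (G : SimpleGraph V) [DecidableRel G.Adj] (bud : V → ℕ) (v : V) : ℕ :=
  G.degree v + bud v

/-- The charge of a vertex of a weighted hypermobile: the weight for a round vertex,
weight plus degree for a light square vertex, and minus weight minus degree for a dark
square vertex. -/
noncomputable def vertexCharge {V : Type*} [Fintype V] [DecidableEq V]
    (G : SimpleGraph V) [DecidableRel G.Adj] (color : V → HColor) (bud : V → ℕ)
    (w : Sym2 V → ℝ) (v : V) : ℝ :=
  match color v with
  | HColor.round => vertexWeight G w v
  | HColor.light => vertexWeight G w v + vertexDegree G bud v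
  | HColor.dark => -vertexWeight G w v - vertexDegree G bud v

open HColor in
/-- If every edge has exactly one dark endpoint, the edges with a round endpoint correspond to
the adjacent pairs consisting of a dark and a round vertex. -/
theorem card_edges_with_round_endpoint {V : Type*} [Fintype V] [DecidableEq V]
    (G : SimpleGraph V) [DecidableRel G.Adj] (color : V → HColor)
    (hedge : ∀ u v, G.Adj u v → (color u = dark ↔ ¬ color v = dark)) :
    (G.edgeFinset.filter (fun e => ∃ v ∈ e, color v = round)).card =
      (univ.filter (fun p : V × V =>
        G.Adj p.1 p.2 ∧ color p.1 = dark ∧ color p.2 = round)).card := by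
  symm
  refine Finset.card_bij (fun p _ => s(p.1, p.2)) ?_ ?_ ?_
  · rintro ⟨a, b⟩ h
    simp only [mem_filter, mem_univ, true_and] at h
    simp only [mem_filter, SimpleGraph.mem_edgeFinset, SimpleGraph.mem_edgeSet]
    exact ⟨h.1, b, Sym2.mem_mk_right a b, h.2.2⟩
  · rintro ⟨a, b⟩ h ⟨c, d⟩ h' heq
    simp only [mem_filter, mem_univ, true_and] at h h'
    rcases Sym2.eq_iff.mp heq with ⟨rfl, rfl⟩ | ⟨rfl, rfl⟩
    · rfl
    · simp_all
  · intro e he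
    simp only [mem_filter, SimpleGraph.mem_edgeFinset] at he
    obtain ⟨hadj, b, ⟨a, rfl⟩, hround⟩ := he
    have hab : G.Adj a b := (SimpleGraph.mem_edgeSet G).mp hadj |>.symm
    refine ⟨(a, b), ?_, Sym2.eq_swap⟩
    simp [hab, hround, (hedge a b hab).mpr (by simp [hround])]

/-- Apart from its buds, the charge of a vertex is a sum of contributions of its neighbors. -/
theorem vertexCharge_eq_bud_add_sum {V : Type*} [Fintype V] [DecidableEq V]
    (G : SimpleGraph V) [DecidableRel G.Adj] (color : V → HColor) (bud : V → ℕ)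
    (hbud : ∀ v, color v ≠ HColor.light → bud v = 0) (w : Sym2 V → ℝ) (v : V) :
    vertexCharge G color bud w v = bud v +
      ((∑ u : V, if G.Adj v u ∧ color v = HColor.dark then -w s(v, u) - 1 else 0) +
        ∑ u : V, if G.Adj v u ∧ color v ≠ HColor.dark then
          w s(v, u) + (if color v = HColor.light then 1 else 0) else 0) := by
  have hb := hbud v
  unfold vertexCharge vertexWeight vertexDegree
  cases h : color v <;>
    simp [h, ← sum_filter, ← SimpleGraph.neighborFinset_eq_filter, sum_add_distrib,
      sum_sub_distrib] at hb ⊢ <;>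
    (try simp only [hb, Nat.cast_zero]) <;> ring

/-- The excess of a weighted hypermobile — the number of edges with a round endpoint minus
the total number of buds — equals minus the sum of the charges of its vertices. -/
theorem excess_eq_neg_sum_charges {V : Type*} [Fintype V] [DecidableEq V]
    (G : SimpleGraph V) [DecidableRel G.Adj] (hG : G.IsTree)
    (color : V → HColor) (bud : V → ℕ)
    (hbud : ∀ v, color v ≠ HColor.light → bud v = 0)
    (hedge : ∀ u v, G.Adj u v → (color u = HColor.dark ↔ ¬ color v = HColor.dark))
    (w : Sym2 V → ℝ) :
    ((G.edgeFinset.filter (fun e => ∃ v ∈ e, color v = HColor.round)).card : ℝ)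
        - ∑ v : V, (bud v : ℝ)
      = - ∑ v : V, vertexCharge G color bud w v := by
  have hcard : ((G.edgeFinset.filter (fun e => ∃ v ∈ e, color v = HColor.round)).card : ℝ) =
      ∑ v : V, ∑ u : V,
        if G.Adj v u ∧ color v = HColor.dark ∧ color u = HColor.round then (1 : ℝ) else 0 := by
    rw [card_edges_with_round_endpoint G color hedge, ← Fintype.sum_prod_type', sum_boole]
  have hpair : (∑ v : V, ∑ u : V,
        if G.Adj v u ∧ color v = HColor.dark then -w s(v, u) - 1 else 0) +
      (∑ v : V, ∑ u : V, if G.Adj v u ∧ color v ≠ HColor.dark then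
          w s(v, u) + (if color v = HColor.light then 1 else 0) else 0) =
      -∑ v : V, ∑ u : V,
        if G.Adj v u ∧ color v = HColor.dark ∧ color u = HColor.round then (1 : ℝ) else 0 := by
    rw [add_comm, sum_comm, ← sum_add_distrib, ← sum_neg_distrib]
    refine sum_congr rfl fun v _ => ?_
    rw [← sum_add_distrib, ← sum_neg_distrib]
    refine sum_congr rfl fun u _ => ?_
    by_cases hadj : G.Adj v u
    · have huv := hedge v u hadj
      rw [Sym2.eq_swap (a := u)]
      cases hv : color v <;> cases hu : color u <;>
        simp [hv, hu, hadj, hadj.symm] at huv ⊢ <;> ring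
    · simp [hadj, G.adj_comm u v]
  simp only [vertexCharge_eq_bud_add_sum G color bud hbud w, sum_add_distrib, hcard]
  linarith
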